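/- arXiv:1810.08278 — 2 statements merged into one kernel-verified Lean document; each statement's English description precedes it below -/
import Mathlib

section
/- Let α, β, α', β' be Borel probability measures on X, and let (f, g) be a pair of continuous functions satisfying f = T_ε(β, g) and g = T_ε(α, f) on all of X. Then the function t ↦ OT_ε(α + t(α' − α), β + t(β' − β)) is right-differentiable at t = 0 with derivative ∫ f d(α' − α) + ∫ g d(β' − β); that is, OT_ε(α + t(α'−α), β + t(β'−β)) = OT_ε(α, β) + t (∫ f d(α'−α) + ∫ g d(β'−β)) + o(t) as t → 0⁺. -/
open MeasureTheory Real Filter Topology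
open scoped NNReal ENNReal

/-- The entropic dual functional `D_ε(α, β; f, g)`. -/
noncomputable def Dfun {X : Type*} [MeasurableSpace X] (eps : ℝ) (C : X → X → ℝ)
    (alpha beta : Measure X) (f g : X → ℝ) : ℝ :=
  (∫ x, f x ∂alpha) + (∫ y, g y ∂beta) -
    eps * ∫ x, ∫ y, (Real.exp ((f x + g y - C x y) / eps) - 1) ∂beta ∂alpha

/-- The entropic transport cost `OT_ε(α, β)`, as a supremum of the dual
functional over pairs of continuous potentials. -/
noncomputable def OTcost {X : Type*} [TopologicalSpace X] [MeasurableSpace X] (eps : ℝ) (C : X → X → ℝ)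
    (alpha beta : Measure X) : ℝ :=
  sSup {r : ℝ | ∃ f g : X → ℝ, Continuous f ∧ Continuous g ∧ r = Dfun eps C alpha beta f g}

/-- The Sinkhorn map `T_ε(α, f)(y) = -ε log ∫ exp((f(x) - C(x,y))/ε) dα(x)`. -/
noncomputable def Tmap {X : Type*} [MeasurableSpace X] (eps : ℝ) (C : X → X → ℝ)
    (alpha : Measure X) (f : X → ℝ) : X → ℝ :=
  fun y => -eps * Real.log (∫ x, Real.exp ((f x - C x y) / eps) ∂alpha)

section

variable {X : Type*} [MetricSpace X] [CompactSpace X] [MeasurableSpace X] [BorelSpace X]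

lemma Continuous.integrable_of_compactSpace {Y : Type*} [TopologicalSpace Y] [CompactSpace Y]
    [MeasurableSpace Y] [OpensMeasurableSpace Y] {φ : Y → ℝ} (hφ : Continuous φ)
    (μ : Measure Y) [IsFiniteMeasure μ] : Integrable φ μ :=
  hφ.integrable_of_hasCompactSupport (HasCompactSupport.of_compactSpace φ)

lemma Continuous.integral_right {k : X → X → ℝ} (hk : Continuous (Function.uncurry k))
    (μ : Measure X) [IsFiniteMeasure μ] : Continuous fun x => ∫ y, k x y ∂μ := by
  simpa using continuous_parametric_integral_of_continuous (μ := μ) hk isCompact_univ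

lemma Continuous.integral_left {k : X → X → ℝ} (hk : Continuous (Function.uncurry k))
    (μ : Measure X) [IsFiniteMeasure μ] : Continuous fun y => ∫ x, k x y ∂μ :=
  Continuous.integral_right (k := fun y x => k x y) (hk.comp continuous_swap) μ

lemma integral_mixture {Y : Type*} [MeasurableSpace Y] {μ ν : Measure Y} {φ : Y → ℝ}
    (hμ : Integrable φ μ) (hν : Integrable φ ν) {t : ℝ} (h0 : 0 ≤ t) (h1 : t ≤ 1) :
    ∫ x, φ x ∂(ENNReal.ofReal (1 - t) • μ + ENNReal.ofReal t • ν)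
      = (1 - t) * ∫ x, φ x ∂μ + t * ∫ x, φ x ∂ν := by
  rw [integral_add_measure (hμ.smul_measure ENNReal.ofReal_ne_top)
    (hν.smul_measure ENNReal.ofReal_ne_top), integral_smul_measure, integral_smul_measure,
    ENNReal.toReal_ofReal h0, ENNReal.toReal_ofReal (sub_nonneg.2 h1)]
  simp

lemma isProbabilityMeasure_mixture {Y : Type*} [MeasurableSpace Y] (μ ν : Measure Y)
    [IsProbabilityMeasure μ] [IsProbabilityMeasure ν] {t : ℝ} (h0 : 0 ≤ t) (h1 : t ≤ 1) :
    IsProbabilityMeasure (ENNReal.ofReal (1 - t) • μ + ENNReal.ofReal t • ν) := by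
  constructor
  simp [← ENNReal.ofReal_add (sub_nonneg.2 h1) h0]

/-- A Young-type inequality, weakening the convex duality between `exp` and the entropy. -/
lemma mul_sub_exp_mul_le {s p H K : ℝ} (hp : 0 ≤ p) (hH : 0 < H) (h : (p - H) ^ 2 ≤ K * H) :
    s * p - (exp s * H - 1) ≤ K - (H - 1) := by
  have h1 : 1 + s / 2 ≤ exp (s / 2) := by linarith [add_one_le_exp (s / 2)]
  have h2 : exp s = exp (s / 2) ^ 2 := by rw [← exp_nat_mul]; congr 1; push_cast; ring
  have h3 := mul_le_mul_of_nonneg_left h1 hp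
  rw [h2]
  set e := exp (s / 2)
  have h4 : 2 * p * e ≤ e ^ 2 * H + p ^ 2 / H := by
    have : e ^ 2 * H + p ^ 2 / H - 2 * p * e = (e * H - p) ^ 2 / H := by field_simp; ring
    have : 0 ≤ (e * H - p) ^ 2 / H := by positivity
    linarith
  have h5 : p ^ 2 / H - 2 * p + H ≤ K := by
    have : p ^ 2 / H - 2 * p + H = (p - H) ^ 2 / H := by field_simp; ring
    rw [this, div_le_iff₀ hH]
    exact h
  linarith

/-- Weak duality against the coupling of `μ` and `ν` with density `p`. -/
lemma Dfun_le_add_of_density {eps : ℝ} (heps : 0 < eps) {C : X → X → ℝ}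
    (hC : Continuous (Function.uncurry C)) (μ ν : Measure X) [IsProbabilityMeasure μ]
    [IsProbabilityMeasure ν] {f g u v : X → ℝ} (hf : Continuous f) (hg : Continuous g)
    (hu : Continuous u) (hv : Continuous v) {p : X → X → ℝ}
    (hp : Continuous (Function.uncurry p)) (hp0 : ∀ x y, 0 ≤ p x y)
    (hpμ : ∀ y, ∫ x, p x y ∂μ = 1) (hpν : ∀ x, ∫ y, p x y ∂ν = 1) {K : ℝ}
    (hK : ∀ x y, (p x y - exp ((f x + g y - C x y) / eps)) ^ 2
      ≤ K * exp ((f x + g y - C x y) / eps)) :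
    Dfun eps C μ ν u v ≤ Dfun eps C μ ν f g + eps * K := by
  have hC' : Continuous fun z : X × X => C z.1 z.2 := hC
  have hp' : Continuous fun z : X × X => p z.1 z.2 := hp
  have i1 := (show Continuous fun z : X × X => (u z.1 - f z.1) * p z.1 z.2 by
    fun_prop).integrable_of_compactSpace (μ.prod ν)
  have i2 := (show Continuous fun z : X × X => (v z.2 - g z.2) * p z.1 z.2 by
    fun_prop).integrable_of_compactSpace (μ.prod ν)
  have i3 := (show Continuous fun z : X × X => exp ((u z.1 + v z.2 - C z.1 z.2) / eps) - 1 by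
    fun_prop).integrable_of_compactSpace (μ.prod ν)
  have i4 := (show Continuous fun z : X × X => exp ((f z.1 + g z.2 - C z.1 z.2) / eps) - 1 by
    fun_prop).integrable_of_compactSpace (μ.prod ν)
  have e1 : ∫ z, (u z.1 - f z.1) * p z.1 z.2 ∂μ.prod ν = ∫ x, u x ∂μ - ∫ x, f x ∂μ := by
    rw [integral_prod _ i1, ← integral_sub (hu.integrable_of_compactSpace μ)
      (hf.integrable_of_compactSpace μ)]
    simp [integral_const_mul, hpν]
  have e2 : ∫ z, (v z.2 - g z.2) * p z.1 z.2 ∂μ.prod ν = ∫ x, v x ∂ν - ∫ x, g x ∂ν := by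
    rw [integral_prod_symm _ i2, ← integral_sub (hv.integrable_of_compactSpace ν)
      (hg.integrable_of_compactSpace ν)]
    simp [integral_const_mul, hpμ]
  have e3 := integral_prod _ i3
  have e4 := integral_prod _ i4
  have key : ∀ z : X × X, (u z.1 - f z.1) * p z.1 z.2 + (v z.2 - g z.2) * p z.1 z.2
      - eps * (exp ((u z.1 + v z.2 - C z.1 z.2) / eps) - 1)
      ≤ eps * K - eps * (exp ((f z.1 + g z.2 - C z.1 z.2) / eps) - 1) := by
    rintro ⟨x, y⟩
    have h := mul_sub_exp_mul_le (s := ((u x - f x) + (v y - g y)) / eps)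
      (hp0 x y) (exp_pos _) (hK x y)
    rw [← exp_add] at h
    have h' := mul_le_mul_of_nonneg_left h heps.le
    have e : ((u x - f x) + (v y - g y)) / eps + (f x + g y - C x y) / eps
        = (u x + v y - C x y) / eps := by ring
    rw [e] at h'
    have e' : eps * (((u x - f x) + (v y - g y)) / eps * p x y)
        = ((u x - f x) + (v y - g y)) * p x y := by field_simp
    dsimp only
    linarith
  have i12 : Integrable (fun z : X × X => (u z.1 - f z.1) * p z.1 z.2
      + (v z.2 - g z.2) * p z.1 z.2) (μ.prod ν) := i1.add i2
  have I := integral_mono (i12.sub (i3.const_mul eps))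
    ((integrable_const (eps * K)).sub (i4.const_mul eps)) key
  simp only [Pi.sub_apply] at I
  rw [integral_sub i12 (i3.const_mul eps), integral_add i1 i2,
    integral_sub (integrable_const _) (i4.const_mul eps), integral_const, integral_const_mul,
    integral_const_mul, e1, e2, e3, e4] at I
  simp only [probReal_univ, one_smul] at I
  simp only [Dfun]
  linarith

lemma OTcost_mem_Icc_of_density {eps : ℝ} (heps : 0 < eps) {C : X → X → ℝ}
    (hC : Continuous (Function.uncurry C)) (μ ν : Measure X) [IsProbabilityMeasure μ]
    [IsProbabilityMeasure ν] {f g : X → ℝ} (hf : Continuous f) (hg : Continuous g)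
    {p : X → X → ℝ} (hp : Continuous (Function.uncurry p)) (hp0 : ∀ x y, 0 ≤ p x y)
    (hpμ : ∀ y, ∫ x, p x y ∂μ = 1) (hpν : ∀ x, ∫ y, p x y ∂ν = 1) {K : ℝ}
    (hK : ∀ x y, (p x y - exp ((f x + g y - C x y) / eps)) ^ 2
      ≤ K * exp ((f x + g y - C x y) / eps)) :
    OTcost eps C μ ν ∈ Set.Icc (Dfun eps C μ ν f g) (Dfun eps C μ ν f g + eps * K) := by
  have hub : ∀ r ∈ {r : ℝ | ∃ u v : X → ℝ, Continuous u ∧ Continuous v ∧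
      r = Dfun eps C μ ν u v}, r ≤ Dfun eps C μ ν f g + eps * K := by
    rintro r ⟨u, v, hu, hv, rfl⟩
    exact Dfun_le_add_of_density heps hC μ ν hf hg hu hv hp hp0 hpμ hpν hK
  exact ⟨le_csSup ⟨_, hub⟩ ⟨f, g, hf, hg, rfl⟩, csSup_le ⟨_, f, g, hf, hg, rfl⟩ hub⟩

lemma hasDerivWithinAt_Ici_zero_of_sq_bound {F : ℝ → ℝ} {L K t₀ : ℝ} (ht₀ : 0 < t₀)
    (h : ∀ t, 0 ≤ t → t ≤ t₀ → |F t - F 0 - t * L| ≤ K * t ^ 2) :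
    HasDerivWithinAt F L (Set.Ici 0) 0 := by
  rw [hasDerivWithinAt_iff_isLittleO]
  have h1 : (fun t => F t - F 0 - (t - 0) • L) =O[𝓝[Set.Ici 0] 0] fun t : ℝ => t ^ 2 := by
    refine Asymptotics.IsBigO.of_bound K ?_
    filter_upwards [self_mem_nhdsWithin, mem_nhdsWithin_of_mem_nhds (Iic_mem_nhds ht₀)]
      with t h0 h2
    simpa using h t h0 h2
  simpa using h1.trans_isLittleO
    ((Asymptotics.isLittleO_pow_id one_lt_two).mono nhdsWithin_le_nhds)

lemma integral_exp_eq_one_of_eq_Tmap {eps : ℝ} (heps : 0 < eps) {C : X → X → ℝ}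
    (hC : Continuous (Function.uncurry C)) (μ : Measure X) [IsProbabilityMeasure μ]
    {f g : X → ℝ} (hf : Continuous f) (h : g = Tmap eps C μ f) (y : X) :
    ∫ x, exp ((f x + g y - C x y) / eps) ∂μ = 1 := by
  have hC' : Continuous fun z : X × X => C z.1 z.2 := hC
  have hi := (show Continuous fun x => exp ((f x - C x y) / eps) by
    fun_prop).integrable_of_compactSpace μ
  have hpos := integral_exp_pos hi
  have hgy : g y / eps = -log (∫ x, exp ((f x - C x y) / eps) ∂μ) := by
    rw [congrFun h y, Tmap]; field_simp
  have e : ∀ x, exp ((f x + g y - C x y) / eps)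
      = exp ((f x - C x y) / eps) * exp (g y / eps) := fun x => by
    rw [← exp_add]; congr 1; ring
  simp only [e]
  rw [integral_mul_const, hgy, exp_neg, exp_log hpos, mul_inv_cancel₀ hpos.ne']

end

/-- `OT_ε` is right-differentiable along the segments
`t ↦ (α + t(α' - α), β + t(β' - β))` at `t = 0`, with derivative
`∫ f d(α' - α) + ∫ g d(β' - β)` given by the extended dual potentials. -/
theorem OTcost_right_differentiable
    {X : Type*} [MetricSpace X] [CompactSpace X] [MeasurableSpace X] [BorelSpace X]
    (eps : ℝ) (heps : 0 < eps) (C : X → X → ℝ) (kappa : ℝ≥0) (hkappa : 0 < kappa)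
    (hCsym : ∀ x y, C x y = C y x)
    (hClip1 : ∀ y, LipschitzWith kappa (fun x => C x y))
    (hClip2 : ∀ x, LipschitzWith kappa (fun y => C x y))
    (alpha beta alpha' beta' : Measure X)
    [IsProbabilityMeasure alpha] [IsProbabilityMeasure beta]
    [IsProbabilityMeasure alpha'] [IsProbabilityMeasure beta']
    (f g : X → ℝ) (hf : Continuous f) (hg : Continuous g)
    (hfixf : f = Tmap eps C beta g) (hfixg : g = Tmap eps C alpha f) :
    HasDerivWithinAt
      (fun t : ℝ => OTcost eps C
        (ENNReal.ofReal (1 - t) • alpha + ENNReal.ofReal t • alpha')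
        (ENNReal.ofReal (1 - t) • beta + ENNReal.ofReal t • beta'))
      (((∫ x, f x ∂alpha') - ∫ x, f x ∂alpha) + ((∫ y, g y ∂beta') - ∫ y, g y ∂beta))
      (Set.Ici 0) 0 := by
  have hC : Continuous (Function.uncurry C) := (LipschitzWith.uncurry hClip1 hClip2).continuous
  have hC' : Continuous fun z : X × X => C z.1 z.2 := hC
  set k : X → X → ℝ := fun x y => exp ((f x + g y - C x y) / eps) - 1 with hkdef
  have hk : Continuous (Function.uncurry k) := by
    change Continuous fun z : X × X => exp ((f z.1 + g z.2 - C z.1 z.2) / eps) - 1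
    fun_prop
  have hk' : Continuous fun z : X × X => k z.1 z.2 := hk
  have hkx : ∀ x, Continuous fun y => k x y := fun x => by fun_prop
  have hky : ∀ y, Continuous fun x => k x y := fun y => by fun_prop
  have hkα : ∀ y, ∫ x, k x y ∂alpha = 0 := fun y => by
    rw [integral_sub (((hky y).add_const 1 |>.congr fun x => by
      simp [hkdef]).integrable_of_compactSpace _) (integrable_const _),
      integral_exp_eq_one_of_eq_Tmap heps hC alpha hf hfixg]
    simp
  have hkβ : ∀ x, ∫ y, k x y ∂beta = 0 := fun x => by
    have h := integral_exp_eq_one_of_eq_Tmap heps hC beta hg hfixf x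
    rw [integral_sub (((hkx x).add_const 1 |>.congr fun y => by
      simp [hkdef]).integrable_of_compactSpace _) (integrable_const _)]
    simp only [hCsym x, add_comm (f x), h]
    simp
  set a : X → ℝ := fun y => ∫ x, k x y ∂alpha' with hadef
  set b : X → ℝ := fun x => ∫ y, k x y ∂beta' with hbdef
  have ha : Continuous a := hk.integral_left alpha'
  have hb : Continuous b := hk.integral_right beta'
  set q : ℝ := ∫ x, b x ∂alpha' with hqdef
  have hswap : ∀ (μ ν : Measure X) [IsProbabilityMeasure μ] [IsProbabilityMeasure ν],
      ∫ x, ∫ y, k x y ∂ν ∂μ = ∫ y, ∫ x, k x y ∂μ ∂ν := fun μ ν _ _ =>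
    integral_integral_swap (hk.integrable_of_compactSpace _)
  have hbα : ∫ x, b x ∂alpha = 0 := by simp [hbdef, hswap alpha beta', hkα]
  have haβ : ∫ y, a y ∂beta = 0 := by simp [hadef, ← hswap alpha' beta, hkβ]
  have haβ' : ∫ y, a y ∂beta' = q := by simp only [hadef, hqdef, hbdef, hswap alpha' beta']
  have : Nonempty X := nonempty_of_isProbabilityMeasure alpha
  obtain ⟨R, hR⟩ : ∃ R, ∀ x y, |k x y| ≤ R := by
    obtain ⟨z, -, hz⟩ := isCompact_univ.exists_isMaxOn Set.univ_nonempty hk'.abs.continuousOn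
    exact ⟨_, fun x y => hz (Set.mem_univ (x, y))⟩
  obtain ⟨m, hm, hmk⟩ : ∃ m, 0 < m ∧ ∀ x y, m ≤ 1 + k x y := by
    obtain ⟨z, -, hz⟩ := isCompact_univ.exists_isMinOn Set.univ_nonempty
      (hk'.const_add 1).continuousOn
    exact ⟨_, by simp [hkdef, exp_pos], fun x y => hz (Set.mem_univ (x, y))⟩
  have habs : ∀ (μ : Measure X) [IsProbabilityMeasure μ] (φ : X → ℝ), (∀ x, |φ x| ≤ R) →
      |∫ x, φ x ∂μ| ≤ R := fun μ _ φ h => by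
    simpa using norm_integral_le_of_norm_le_const (μ := μ) (f := φ) (C := R) (.of_forall h)
  have haR : ∀ y, |a y| ≤ R := fun y => habs _ _ fun x => hR x y
  have hbR : ∀ x, |b x| ≤ R := fun x => habs _ _ (hR x)
  have hqR : |q| ≤ R := habs _ _ hbR
  have hR0 : 0 ≤ R := (abs_nonneg _).trans hqR
  set K := 9 * R ^ 2 / m with hKdef
  set L := ((∫ x, f x ∂alpha') - ∫ x, f x ∂alpha) + ((∫ y, g y ∂beta') - ∫ y, g y ∂beta)
  set E := ∫ x, f x ∂alpha + ∫ y, g y ∂beta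
  have hmain : ∀ t, 0 ≤ t → t ≤ min 1 (m / (3 * R + 1)) →
      OTcost eps C (ENNReal.ofReal (1 - t) • alpha + ENNReal.ofReal t • alpha')
        (ENNReal.ofReal (1 - t) • beta + ENNReal.ofReal t • beta') ∈
      Set.Icc (E + t * L - eps * (t ^ 2 * q))
        (E + t * L - eps * (t ^ 2 * q) + eps * (K * t ^ 2)) := by
    intro t h0 ht
    have h1 : t ≤ 1 := ht.trans (min_le_left _ _)
    have htm : t * (3 * R + 1) ≤ m :=
      (le_div_iff₀ (by positivity)).1 (ht.trans (min_le_right _ _))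
    have hα := isProbabilityMeasure_mixture alpha alpha' h0 h1
    have hβ := isProbabilityMeasure_mixture beta beta' h0 h1
    have mixα : ∀ φ : X → ℝ, Continuous φ →
        ∫ x, φ x ∂(ENNReal.ofReal (1 - t) • alpha + ENNReal.ofReal t • alpha')
          = (1 - t) * ∫ x, φ x ∂alpha + t * ∫ x, φ x ∂alpha' := fun φ hφ =>
      integral_mixture (hφ.integrable_of_compactSpace _) (hφ.integrable_of_compactSpace _) h0 h1
    have mixβ : ∀ φ : X → ℝ, Continuous φ →
        ∫ x, φ x ∂(ENNReal.ofReal (1 - t) • beta + ENNReal.ofReal t • beta')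
          = (1 - t) * ∫ x, φ x ∂beta + t * ∫ x, φ x ∂beta' := fun φ hφ =>
      integral_mixture (hφ.integrable_of_compactSpace _) (hφ.integrable_of_compactSpace _) h0 h1
    set αt := ENNReal.ofReal (1 - t) • alpha + ENNReal.ofReal t • alpha'
    set βt := ENNReal.ofReal (1 - t) • beta + ENNReal.ofReal t • beta'
    have hD : Dfun eps C αt βt f g = E + t * L - eps * (t ^ 2 * q) := by
      have e1 : ∀ x, ∫ y, (exp ((f x + g y - C x y) / eps) - 1) ∂βt = t * b x := fun x => by
        rw [mixβ _ (hkx x), hkβ]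
        ring
      rw [Dfun, mixα f hf, mixβ g hg]
      simp only [e1]
      rw [integral_const_mul, mixα b hb, hbα]
      ring
    rw [← hD]
    set p : X → X → ℝ := fun x y => 1 + k x y - t * a y - t * b x + t ^ 2 * q with hpdef
    have hpH : ∀ x y, |p x y - exp ((f x + g y - C x y) / eps)| ≤ 3 * R * t := fun x y => by
      have e : p x y - exp ((f x + g y - C x y) / eps) = t * (t * q - a y - b x) := by
        simp only [hpdef, hkdef]; ring
      rw [e, abs_mul, abs_of_nonneg h0]
      have h2 : |t * q| ≤ R := by
        rw [abs_mul, abs_of_nonneg h0]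
        nlinarith [abs_nonneg q]
      have h3 : |t * q - a y - b x| ≤ 3 * R := by
        have := haR y
        have := hbR x
        rw [abs_le] at *
        constructor <;> linarith
      nlinarith
    have hHk : ∀ x y, m ≤ exp ((f x + g y - C x y) / eps) := fun x y => by
      simpa [hkdef] using hmk x y
    refine OTcost_mem_Icc_of_density heps hC αt βt hf hg (p := p) ?_ ?_ ?_ ?_ ?_
    · change Continuous fun z : X × X => 1 + k z.1 z.2 - t * a z.2 - t * b z.1 + t ^ 2 * q
      fun_prop
    · intro x y
      have := (abs_le.1 (hpH x y)).1
      have := hHk x y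
      nlinarith
    · intro y
      have e : ∀ μ : Measure X, IsProbabilityMeasure μ →
          ∫ x, p x y ∂μ = 1 + ∫ x, k x y ∂μ - t * a y - t * ∫ x, b x ∂μ + t ^ 2 * q := by
        intro μ _
        have j1 := (hky y).integrable_of_compactSpace μ
        have j2 := hb.integrable_of_compactSpace μ
        simp only [hpdef]
        rw [integral_add (by fun_prop) (by fun_prop), integral_sub (by fun_prop) (by fun_prop),
          integral_sub (by fun_prop) (by fun_prop), integral_add (by fun_prop) (by fun_prop)]
        simp [integral_const_mul]
      rw [e αt hα, mixα _ (hky y), mixα b hb, hkα, hbα]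
      change 1 + ((1 - t) * 0 + t * a y) - t * a y - t * ((1 - t) * 0 + t * q) + t ^ 2 * q = 1
      ring
    · intro x
      have e : ∀ μ : Measure X, IsProbabilityMeasure μ →
          ∫ y, p x y ∂μ = 1 + ∫ y, k x y ∂μ - t * ∫ y, a y ∂μ - t * b x + t ^ 2 * q := by
        intro μ _
        have j1 := (hkx x).integrable_of_compactSpace μ
        have j2 := ha.integrable_of_compactSpace μ
        simp only [hpdef]
        rw [integral_add (by fun_prop) (by fun_prop), integral_sub (by fun_prop) (by fun_prop),
          integral_sub (by fun_prop) (by fun_prop), integral_add (by fun_prop) (by fun_prop)]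
        simp [integral_const_mul]
      rw [e βt hβ, mixβ _ (hkx x), mixβ a ha, hkβ, haβ, haβ']
      change 1 + ((1 - t) * 0 + t * b x) - t * ((1 - t) * 0 + t * q) - t * b x + t ^ 2 * q = 1
      ring
    · intro x y
      have h2 : (p x y - exp ((f x + g y - C x y) / eps)) ^ 2 ≤ (3 * R * t) ^ 2 :=
        sq_le_sq' (abs_le.1 (hpH x y)).1 (abs_le.1 (hpH x y)).2
      refine h2.trans ?_
      have h3 : K * t ^ 2 * m = (3 * R * t) ^ 2 := by rw [hKdef]; field_simp; ring
      rw [← h3]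
      exact mul_le_mul_of_nonneg_left (hHk x y) (by positivity)
  have ht₀ : 0 < min 1 (m / (3 * R + 1)) := lt_min one_pos (by positivity)
  refine hasDerivWithinAt_Ici_zero_of_sq_bound (K := eps * (R + K)) ht₀ fun t h0 ht => ?_
  have hF0 := hmain 0 le_rfl ht₀.le
  have hFt := hmain t h0 ht
  simp only [Set.mem_Icc] at hF0 hFt
  have hK0 : 0 ≤ K := by positivity
  have hq1 : eps * (t ^ 2 * q) ≤ eps * (t ^ 2 * R) := by gcongr; exact (abs_le.1 hqR).2
  have hq2 : eps * (t ^ 2 * (-R)) ≤ eps * (t ^ 2 * q) := by gcongr; exact (abs_le.1 hqR).1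
  have hK2 : 0 ≤ eps * (K * t ^ 2) := by positivity
  rw [abs_le]
  constructor <;> nlinarith
end

section
/- For all finite Borel measures α, β on a compact metric space X, the Kullback–Leibler divergence admits the dual representation over continuous test functions: KL(α, β) = sup over continuous functions h : X → ℝ of ∫ h dα − ∫ (e^h − 1) dβ. -/
open MeasureTheory Real Filter Topology
open scoped NNReal ENNReal

open scoped Classical in
/-- The Kullback-Leibler divergence `KL(α, β) = ∫ log(dα/dβ) dα - α(X) + β(X)`
if `α ≪ β` (and the log-density is `α`-integrable; since the negative part of
the relevant integrand is always integrable for finite measures, the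
non-integrable case corresponds to the value `+∞`), and `+∞` otherwise. -/
noncomputable def KLdiv {X : Type*} [MeasurableSpace X] (alpha beta : Measure X) : EReal :=
  if alpha ≪ beta ∧ Integrable (fun x => Real.log ((alpha.rnDeriv beta x).toReal)) alpha then
    (((∫ x, Real.log ((alpha.rnDeriv beta x).toReal) ∂alpha)
      - (alpha Set.univ).toReal + (beta Set.univ).toReal : ℝ) : EReal)
  else ⊤

/-- The divergence `KLdiv` agrees with Mathlib's `[0, ∞]`-valued divergence `klDiv`. -/
theorem KLdiv_eq_klDiv {X : Type*} [MeasurableSpace X] (alpha beta : Measure X)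
    [IsFiniteMeasure alpha] [IsFiniteMeasure beta] :
    KLdiv alpha beta = (InformationTheory.klDiv alpha beta : EReal) := by
  unfold KLdiv
  split_ifs with h
  · rw [InformationTheory.klDiv_of_ac_of_integrable h.1 h.2, EReal.coe_ennreal_ofReal,
      max_eq_left (InformationTheory.integral_llr_add_sub_measure_univ_nonneg h.1 h.2)]
    congr 1
    simp only [llr, Measure.real]
    ring
  · have h' : InformationTheory.klDiv alpha beta = ⊤ := by
      rw [InformationTheory.klDiv_eq_top_iff]
      exact fun h1 h2 => h ⟨h1, h2⟩
    simp [h']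

/-- The functional maximised in the dual formulation of the Kullback-Leibler divergence. -/
noncomputable def dualFunctional {X : Type*} [MeasurableSpace X] (alpha beta : Measure X)
    (h : X → ℝ) : ℝ :=
  (∫ x, h x ∂alpha) - ∫ x, (Real.exp (h x) - 1) ∂beta

/-- Fenchel-Young inequality for the pair `klFun`, `exp - 1`. -/
theorem mul_sub_exp_sub_one_le_klFun {r : ℝ} (hr : 0 ≤ r) (t : ℝ) :
    r * t - (Real.exp t - 1) ≤ InformationTheory.klFun r := by
  rw [InformationTheory.klFun_apply]
  rcases hr.eq_or_lt with rfl | hr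
  · have := Real.exp_pos t
    simp
    linarith
  · have h1 := Real.add_one_le_exp (t - Real.log r)
    rw [Real.exp_sub, Real.exp_log hr] at h1
    have h2 : (t - Real.log r + 1) * r ≤ Real.exp t := (le_div_iff₀ hr).1 h1
    linarith

/-- An upper bound of the dual functional over bounded measurable functions is infinite
when `alpha` is not absolutely continuous with respect to `beta`. -/
theorem eq_top_of_forall_dualFunctional_le {X : Type*} [MeasurableSpace X]
    {alpha beta : Measure X} [IsFiniteMeasure alpha] (hac : ¬ alpha ≪ beta) {S : EReal}
    (hS : ∀ h : X → ℝ, Measurable h → ∀ M : ℝ, (∀ x, |h x| ≤ M) →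
      (dualFunctional alpha beta h : EReal) ≤ S) : S = ⊤ := by
  obtain ⟨A, hA, hbA, haA⟩ : ∃ A, MeasurableSet A ∧ beta A = 0 ∧ alpha A ≠ 0 := by
    by_contra! H
    exact hac (Measure.AbsolutelyContinuous.mk fun s hs h0 => H s hs h0)
  have hpos : 0 < alpha.real A := ENNReal.toReal_pos haA (measure_ne_top _ _)
  rw [EReal.eq_top_iff_forall_lt]
  intro y
  obtain ⟨n, hn⟩ := exists_nat_gt (y / alpha.real A)
  rw [div_lt_iff₀ hpos] at hn
  refine lt_of_lt_of_le (EReal.coe_lt_coe_iff.2 hn) ?_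
  have key : dualFunctional alpha beta (A.indicator fun _ => (n : ℝ)) = n * alpha.real A := by
    have h0 : (fun x => Real.exp (A.indicator (fun _ => (n : ℝ)) x) - 1) =ᵐ[beta] 0 := by
      filter_upwards [measure_eq_zero_iff_ae_notMem.1 hbA] with x hx
      simp [hx]
    rw [dualFunctional, integral_congr_ae h0, integral_indicator hA]
    simp [mul_comm]
  rw [← key]
  refine hS _ (measurable_const.indicator hA) n fun x => ?_
  by_cases hx : x ∈ A <;> simp [hx]

section Measurable

variable {X : Type*} [MeasurableSpace X] {alpha beta : Measure X}
  [IsFiniteMeasure alpha] [IsFiniteMeasure beta]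

theorem integrable_of_measurable_of_abs_le {mu : Measure X} [IsFiniteMeasure mu] {h : X → ℝ}
    (hm : Measurable h) {M : ℝ} (hM : ∀ x, |h x| ≤ M) : Integrable h mu :=
  Integrable.of_bound hm.aestronglyMeasurable M (ae_of_all _ hM)

theorem integrable_exp_sub_one_of_abs_le {mu : Measure X} [IsFiniteMeasure mu] {h : X → ℝ}
    (hm : Measurable h) {M : ℝ} (hM : ∀ x, |h x| ≤ M) :
    Integrable (fun x => Real.exp (h x) - 1) mu := by
  refine Integrable.sub ?_ (integrable_const 1)
  refine integrable_of_measurable_of_abs_le (M := Real.exp M) (by fun_prop) fun x => ?_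
  rw [abs_of_pos (Real.exp_pos _)]
  exact Real.exp_le_exp.2 ((le_abs_self _).trans (hM x))

theorem integrable_rnDeriv_mul (hac : alpha ≪ beta) {h : X → ℝ} (hi : Integrable h alpha) :
    Integrable (fun x => (alpha.rnDeriv beta x).toReal * h x) beta :=
  (integrable_rnDeriv_smul_iff hac).2 hi

theorem dualFunctional_eq_integral (hac : alpha ≪ beta) {h : X → ℝ}
    (hm : Measurable h) {M : ℝ} (hM : ∀ x, |h x| ≤ M) :
    dualFunctional alpha beta h =
      ∫ x, ((alpha.rnDeriv beta x).toReal * h x - (Real.exp (h x) - 1)) ∂beta := by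
  rw [integral_sub (integrable_rnDeriv_mul hac (integrable_of_measurable_of_abs_le hm hM))
    (integrable_exp_sub_one_of_abs_le hm hM), dualFunctional, ← integral_rnDeriv_smul hac]
  rfl

/-- Weak duality. -/
theorem dualFunctional_le_klDiv {h : X → ℝ}
    (hm : Measurable h) {M : ℝ} (hM : ∀ x, |h x| ≤ M) :
    (dualFunctional alpha beta h : EReal) ≤ InformationTheory.klDiv alpha beta := by
  by_cases H : alpha ≪ beta ∧ Integrable (llr alpha beta) alpha
  · obtain ⟨hac, hint⟩ := H
    rw [InformationTheory.klDiv_eq_integral_klFun, if_pos ⟨hac, hint⟩, EReal.coe_ennreal_ofReal,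
      EReal.coe_le_coe_iff, dualFunctional_eq_integral hac hm hM]
    refine le_max_of_le_left (integral_mono ?_ ?_ ?_)
    · exact (integrable_rnDeriv_mul hac (integrable_of_measurable_of_abs_le hm hM)).sub
        (integrable_exp_sub_one_of_abs_le hm hM)
    · exact (InformationTheory.integrable_klFun_rnDeriv_iff hac).2 hint
    · exact fun x => mul_sub_exp_sub_one_le_klFun ENNReal.toReal_nonneg _
  · have h' : InformationTheory.klDiv alpha beta = ⊤ := by
      rw [InformationTheory.klDiv_eq_top_iff]
      exact fun h1 h2 => H ⟨h1, h2⟩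
    simp [h']

/-- Truncation of `r` to the interval `[exp (-n), exp n]`. -/
noncomputable def expClamp (n : ℕ) (r : ℝ) : ℝ :=
  max (Real.exp (-n)) (min r (Real.exp n))

theorem expClamp_pos (n : ℕ) (r : ℝ) : 0 < expClamp n r :=
  lt_max_of_lt_left (Real.exp_pos _)

@[fun_prop]
theorem measurable_expClamp (n : ℕ) : Measurable (expClamp n) := by
  unfold expClamp
  fun_prop

theorem abs_log_expClamp_le (n : ℕ) (r : ℝ) : |Real.log (expClamp n r)| ≤ n := by
  have hn : (0 : ℝ) ≤ n := n.cast_nonneg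
  rw [abs_le]
  constructor
  · rw [Real.le_log_iff_exp_le (expClamp_pos n r)]
    exact le_max_left _ _
  · rw [Real.log_le_iff_le_exp (expClamp_pos n r)]
    exact max_le (Real.exp_le_exp.2 (by linarith)) (min_le_right _ _)

theorem tendsto_expClamp {r : ℝ} (hr : 0 ≤ r) :
    Tendsto (fun n => expClamp n r) atTop (𝓝 r) := by
  have h1 : Tendsto (fun n : ℕ => Real.exp (-(n : ℝ))) atTop (𝓝 0) :=
    Real.tendsto_exp_neg_atTop_nhds_zero.comp tendsto_natCast_atTop_atTop
  have h2 : Tendsto (fun n : ℕ => min r (Real.exp n)) atTop (𝓝 r) := by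
    refine tendsto_const_nhds.congr' ?_
    filter_upwards [(Real.tendsto_exp_atTop.comp
      (tendsto_natCast_atTop_atTop (R := ℝ))).eventually_ge_atTop r] with n hn
    exact (min_eq_left hn).symm
  simpa only [expClamp, max_eq_right hr] using h1.max h2

theorem klFun_expClamp_le (n : ℕ) (r : ℝ) :
    InformationTheory.klFun (expClamp n r) ≤
      r * Real.log (expClamp n r) - (Real.exp (Real.log (expClamp n r)) - 1) := by
  rw [InformationTheory.klFun_apply, Real.exp_log (expClamp_pos n r)]
  suffices 0 ≤ (r - expClamp n r) * Real.log (expClamp n r) by linarith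
  have hn : (0 : ℝ) ≤ n := n.cast_nonneg
  have hle : Real.exp (-(n : ℝ)) ≤ Real.exp n := Real.exp_le_exp.2 (by linarith)
  rcases le_total r (Real.exp (-n)) with h | h
  · have : expClamp n r = Real.exp (-n) := by
      rw [expClamp, min_eq_left (h.trans hle), max_eq_left h]
    rw [this, Real.log_exp]
    nlinarith
  rcases le_total r (Real.exp n) with h' | h'
  · have : expClamp n r = r := by rw [expClamp, min_eq_left h', max_eq_right h]
    simp [this]
  · have : expClamp n r = Real.exp n := by rw [expClamp, min_eq_right h', max_eq_right hle]
    rw [this, Real.log_exp]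
    nlinarith

/-- Strong duality over bounded measurable functions. -/
theorem klDiv_le_of_forall_dualFunctional_le {S : EReal}
    (hS : ∀ h : X → ℝ, Measurable h → ∀ M : ℝ, (∀ x, |h x| ≤ M) →
      (dualFunctional alpha beta h : EReal) ≤ S) :
    (InformationTheory.klDiv alpha beta : EReal) ≤ S := by
  by_cases hac : alpha ≪ beta
  swap
  · simp [eq_top_of_forall_dualFunctional_le hac hS]
  have hS0 : 0 ≤ S := by
    simpa [dualFunctional] using hS (fun _ => 0) measurable_const 0 (by simp)
  rw [← EReal.coe_toENNReal hS0, EReal.coe_ennreal_le_coe_ennreal_iff,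
    InformationTheory.klDiv_eq_lintegral_klFun_of_ac hac]
  let r : X → ℝ := fun x => (alpha.rnDeriv beta x).toReal
  have hr : Measurable r := (Measure.measurable_rnDeriv _ _).ennreal_toReal
  let F : ℕ → X → ℝ≥0∞ := fun n x =>
    ENNReal.ofReal (InformationTheory.klFun (expClamp n (r x)))
  have hF : ∀ n, Measurable (F n) := fun n =>
    (InformationTheory.measurable_klFun.comp ((measurable_expClamp n).comp hr)).ennreal_ofReal
  have hlim : ∀ x, Tendsto (fun n => F n x) atTop
      (𝓝 (ENNReal.ofReal (InformationTheory.klFun (r x)))) := fun x =>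
    (ENNReal.continuous_ofReal.comp InformationTheory.continuous_klFun).continuousAt.tendsto.comp
      (tendsto_expClamp ENNReal.toReal_nonneg)
  have hbound : ∀ n, ∫⁻ x, F n x ∂beta ≤ S.toENNReal := by
    intro n
    let h : X → ℝ := fun x => Real.log (expClamp n (r x))
    have hm : Measurable h := Real.measurable_log.comp ((measurable_expClamp n).comp hr)
    have hM : ∀ x, |h x| ≤ n := fun x => abs_log_expClamp_le n _
    have hle : ∀ x, InformationTheory.klFun (expClamp n (r x)) ≤
        r x * h x - (Real.exp (h x) - 1) := fun x => klFun_expClamp_le n _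
    calc ∫⁻ x, F n x ∂beta
        ≤ ∫⁻ x, ENNReal.ofReal (r x * h x - (Real.exp (h x) - 1)) ∂beta :=
          lintegral_mono fun x => ENNReal.ofReal_le_ofReal (hle x)
      _ = ENNReal.ofReal (dualFunctional alpha beta h) := by
          rw [dualFunctional_eq_integral hac hm hM, ofReal_integral_eq_lintegral_ofReal]
          · exact (integrable_rnDeriv_mul hac (integrable_of_measurable_of_abs_le hm hM)).sub
              (integrable_exp_sub_one_of_abs_le hm hM)
          · exact ae_of_all _ fun x =>
              (InformationTheory.klFun_nonneg (expClamp_pos n _).le).trans (hle x)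
      _ ≤ S.toENNReal := by
          rw [← EReal.coe_ennreal_le_coe_ennreal_iff, EReal.coe_toENNReal hS0,
            EReal.coe_ennreal_ofReal, EReal.coe_strictMono.monotone.map_max]
          exact max_le (hS h hm n hM) hS0
  calc ∫⁻ x, ENNReal.ofReal (InformationTheory.klFun (r x)) ∂beta
      = ∫⁻ x, liminf (fun n => F n x) atTop ∂beta :=
        lintegral_congr fun x => (hlim x).liminf_eq.symm
    _ ≤ liminf (fun n => ∫⁻ x, F n x ∂beta) atTop := lintegral_liminf_le hF
    _ ≤ S.toENNReal :=
        liminf_le_of_frequently_le' (Frequently.of_forall hbound)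

end Measurable

theorem abs_exp_sub_exp_le {s t M : ℝ} (hs : s ≤ M) (ht : t ≤ M) :
    |Real.exp s - Real.exp t| ≤ Real.exp M * |s - t| := by
  wlog hst : t ≤ s generalizing s t
  · rw [abs_sub_comm, abs_sub_comm s]
    exact this ht hs (le_of_not_ge hst)
  rw [abs_of_nonneg (sub_nonneg.2 (Real.exp_le_exp.2 hst)), abs_of_nonneg (sub_nonneg.2 hst)]
  have h1 := Real.add_one_le_exp (t - s)
  have h2 : Real.exp t = Real.exp s * Real.exp (t - s) := by rw [← Real.exp_add]; congr 1; ring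
  have h3 := Real.exp_le_exp.2 hs
  have h4 := Real.exp_pos s
  nlinarith

/-- The dual functional at a bounded measurable function is approximated from below by its
values at continuous functions. -/
theorem exists_continuous_dualFunctional_ge {X : Type*} [MetricSpace X] [CompactSpace X]
    [MeasurableSpace X] [BorelSpace X] {alpha beta : Measure X}
    [IsFiniteMeasure alpha] [IsFiniteMeasure beta] {h : X → ℝ}
    (hm : Measurable h) {M : ℝ} (hM : ∀ x, |h x| ≤ M) {ε : ℝ} (hε : 0 < ε) :
    ∃ g : X → ℝ, Continuous g ∧
      dualFunctional alpha beta h - ε ≤ dualFunctional alpha beta g := by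
  have hC : 0 < 1 + Real.exp M := by positivity
  obtain ⟨f, hf, hfi⟩ := (integrable_of_measurable_of_abs_le (mu := alpha + beta) hm
    hM).exists_boundedContinuous_integral_sub_le (div_pos hε hC)
  let g : X → ℝ := fun x => max (-M) (min (f x) M)
  have hgc : Continuous g := by fun_prop
  have hgM : ∀ x, |g x| ≤ M := fun x => by
    have := (abs_nonneg _).trans (hM x)
    exact abs_le.2 ⟨le_max_left _ _, max_le (by linarith) (min_le_right _ _)⟩
  have hgm : Measurable g := hgc.measurable
  have hhg : ∀ x, |h x - g x| ≤ ‖h x - f x‖ := fun x => by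
    obtain ⟨h1, h2⟩ := abs_le.1 (hM x)
    have hx : h x = max (-M) (min (h x) M) := by rw [min_eq_left h2, max_eq_right h1]
    calc |h x - g x| = |max (min (h x) M) (-M) - max (min (f x) M) (-M)| := by
          rw [max_comm (min (h x) M), ← hx, max_comm]
      _ ≤ |min (h x) M - min (f x) M| := abs_max_sub_max_le_abs _ _ _
      _ ≤ |h x - f x| := abs_min_sub_min_le_max _ _ _ _ |>.trans (by simp)
  have hdm : Measurable fun x => h x - g x := hm.sub hgm
  have hdi : ∀ mu : Measure X, IsFiniteMeasure mu → Integrable (fun x => |h x - g x|) mu :=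
    fun mu _ => ((integrable_of_measurable_of_abs_le hm hM).sub
      (integrable_of_measurable_of_abs_le hgm hgM)).abs
  have hda := hdi alpha inferInstance
  have hdb := hdi beta inferInstance
  have htot : (∫ x, |h x - g x| ∂alpha) + ∫ x, |h x - g x| ∂beta ≤ ε / (1 + Real.exp M) := by
    rw [← integral_add_measure hda hdb]
    refine (integral_mono (hdi _ inferInstance) ?_ hhg).trans hf
    exact ((integrable_of_measurable_of_abs_le hm hM).sub hfi).norm
  have hA : (∫ x, h x ∂alpha) - ∫ x, g x ∂alpha ≤ ∫ x, |h x - g x| ∂alpha := by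
    have hi := integrable_of_measurable_of_abs_le (mu := alpha) hm hM
    have gi := integrable_of_measurable_of_abs_le (mu := alpha) hgm hgM
    rw [← integral_sub hi gi]
    exact integral_mono (hi.sub gi) hda fun x => le_abs_self _
  have hB : (∫ x, (Real.exp (g x) - 1) ∂beta) - ∫ x, (Real.exp (h x) - 1) ∂beta ≤
      Real.exp M * ∫ x, |h x - g x| ∂beta := by
    have hi := integrable_exp_sub_one_of_abs_le (mu := beta) hm hM
    have gi := integrable_exp_sub_one_of_abs_le (mu := beta) hgm hgM
    rw [← integral_sub gi hi, ← integral_const_mul]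
    refine integral_mono (gi.sub hi) (hdb.const_mul _) fun x => ?_
    have := abs_exp_sub_exp_le ((le_abs_self _).trans (hgM x)) ((le_abs_self _).trans (hM x))
    rw [abs_sub_comm (g x)] at this
    have := (le_abs_self _).trans this
    simp only
    linarith
  refine ⟨g, hgc, ?_⟩
  have ha0 : 0 ≤ ∫ x, |h x - g x| ∂alpha := integral_nonneg fun x => abs_nonneg _
  have hb0 : 0 ≤ ∫ x, |h x - g x| ∂beta := integral_nonneg fun x => abs_nonneg _
  rw [le_div_iff₀ hC] at htot
  have := Real.exp_pos M
  unfold dualFunctional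
  nlinarith

/-- Dual representation of the Kullback-Leibler divergence over
continuous test functions. -/
theorem KLdiv_dual_continuous
    {X : Type*} [MetricSpace X] [CompactSpace X] [MeasurableSpace X] [BorelSpace X]
    (alpha beta : Measure X) [IsFiniteMeasure alpha] [IsFiniteMeasure beta] :
    KLdiv alpha beta =
      sSup {r : EReal | ∃ h : X → ℝ, Continuous h ∧
        r = (((∫ x, h x ∂alpha) - ∫ x, (Real.exp (h x) - 1) ∂beta : ℝ) : EReal)} := by
  rw [KLdiv_eq_klDiv]
  apply le_antisymm
  · refine klDiv_le_of_forall_dualFunctional_le fun h hm M hM => ?_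
    refine le_of_forall_lt_imp_le_of_dense fun c hc => ?_
    obtain ⟨q, hcq, hq⟩ := EReal.lt_iff_exists_real_btwn.1 hc
    obtain ⟨g, hg, hle⟩ := exists_continuous_dualFunctional_ge (alpha := alpha) (beta := beta)
      hm hM (sub_pos.2 (EReal.coe_lt_coe_iff.1 hq))
    rw [sub_sub_cancel] at hle
    exact (hcq.le.trans (EReal.coe_le_coe_iff.2 hle)).trans (le_sSup ⟨g, hg, rfl⟩)
  · refine sSup_le ?_
    rintro _ ⟨h, hc, rfl⟩
    obtain ⟨M, hM⟩ := isCompact_univ.exists_bound_of_continuousOn hc.continuousOn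
    exact dualFunctional_le_klDiv hc.measurable fun x => hM x (Set.mem_univ x)
end
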